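/- arXiv:2112.14354 — 2 statements merged into one kernel-verified Lean document; each statement's English description precedes it below -/
import Mathlib

section
/- Let n ≥ 1, let λ be a C-partition of n, and assume |μ(λ)| ≠ 2. Set d(λ) = ((λ^t)^+)_B. Then |μ(λ)| is even, μ(λ) is a special D-partition, μ(λ) ⊆ d(λ), and d(λ) ∖ μ(λ) is a special B-partition. -/
namespace WFPaper

/-- The list of parts of a partition (multiset of positive integers) in weakly
decreasing order. -/
def sortedDesc (s : Multiset ℕ) : List ℕ := (s.sort (· ≤ ·)).reverse

/-- The `j`-th largest part of `s` (1-indexed); `0` if `j = 0` or `j > #s`. -/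
def part (s : Multiset ℕ) (j : ℕ) : ℕ := (sortedDesc s).getD (j - 1) 0

/-- The smallest part of `s` (`0` if `s` is empty). -/
def minPart (s : Multiset ℕ) : ℕ := (s.sort (· ≤ ·)).getD 0 0

/-- Sum of the `j` largest parts of `s`. -/
def psum (s : Multiset ℕ) (j : ℕ) : ℕ := ((sortedDesc s).take j).sum

/-- Dominance order: `DomLE a b` means `a ≤ b` in the dominance order, i.e.
for every `j` the sum of the `j` largest parts of `a` is at most that of `b`. -/
def DomLE (a b : Multiset ℕ) : Prop := ∀ j, psum a j ≤ psum b j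

/-- All parts are positive. -/
def PosParts (s : Multiset ℕ) : Prop := ∀ x ∈ s, 0 < x

/-- A partition of an odd number in which every even part has even multiplicity
(a B-partition of `n` when the sum is `2*n+1`). -/
def IsTypeB (s : Multiset ℕ) : Prop :=
  PosParts s ∧ Odd s.sum ∧ ∀ x, Even x → Even (s.count x)

/-- A partition of an even number in which every odd part has even multiplicity
(a C-partition of `n` when the sum is `2*n`). -/
def IsTypeC (s : Multiset ℕ) : Prop :=
  PosParts s ∧ Even s.sum ∧ ∀ x, Odd x → Even (s.count x)

/-- A partition of an even number in which every even part has even multiplicity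
(a D-partition of `n` when the sum is `2*n`). -/
def IsTypeD (s : Multiset ℕ) : Prop :=
  PosParts s ∧ Even s.sum ∧ ∀ x, Even x → Even (s.count x)

/-- `IsCollapse T α β` : `β` is the dominance-largest partition of class `T` of
the same number as `α` which is dominated by `α` (e.g. the B/C/D-collapse of `α`
for `T = IsTypeB/IsTypeC/IsTypeD`). -/
def IsCollapse (T : Multiset ℕ → Prop) (α β : Multiset ℕ) : Prop :=
  T β ∧ β.sum = α.sum ∧ DomLE β α ∧
    ∀ γ, T γ → γ.sum = α.sum → DomLE γ α → DomLE γ β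

/-- The transpose (conjugate) partition: its `j`-th part (0-indexed `j`) is the
number of parts of `s` that are `≥ j+1`. -/
def transpose (s : Multiset ℕ) : Multiset ℕ :=
  (Multiset.range (part s 1)).map (fun j => (s.filter (fun x => j + 1 ≤ x)).card)

/-- `λ⁻` : subtract 1 from the smallest part (the part being deleted if it
becomes 0). -/
def decMin (s : Multiset ℕ) : Multiset ℕ :=
  ((minPart s - 1) ::ₘ s.erase (minPart s)).filter (fun x => 0 < x)

/-- `λ⁺` : add 1 to the largest part. -/
def incMax (s : Multiset ℕ) : Multiset ℕ :=
  (part s 1 + 1) ::ₘ s.erase (part s 1)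

/-- The subpartition `μ` of `T` whose multiplicity at an even `x` is 2 if
`m_T(x)` is even and nonzero, 1 if `m_T(x)` is odd, and 0 at odd `x`. -/
def muEven (T : Multiset ℕ) : Multiset ℕ :=
  (T.toFinset.filter (fun x => Even x)).val.bind
    (fun x => Multiset.replicate (if Even (T.count x) then 2 else 1) x)

/-- The subpartition `μ` of `T` whose multiplicity at an odd `x` is 2 if
`m_T(x)` is even and nonzero, 1 if `m_T(x)` is odd, and 0 at even `x`. -/
def muOdd (T : Multiset ℕ) : Multiset ℕ :=
  (T.toFinset.filter (fun x => Odd x)).val.bind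
    (fun x => Multiset.replicate (if Even (T.count x) then 2 else 1) x)

/-- The subpartition `π` of `T` consisting of the even parts of `T` of odd
multiplicity, each taken once. -/
def piEven (T : Multiset ℕ) : Multiset ℕ :=
  (T.toFinset.filter (fun x => Even x ∧ Odd (T.count x))).val

/-- `k` is a (1-indexed) position of an odd part of `s`. -/
def OddIdx (s : Multiset ℕ) (k : ℕ) : Prop := 1 ≤ k ∧ Odd (part s k)

/-- `k` is a (1-indexed) position of an even part of `s`. -/
def EvenIdx (s : Multiset ℕ) (k : ℕ) : Prop :=
  1 ≤ k ∧ k ≤ Multiset.card s ∧ Even (part s k)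

/-- `e_s(i,j)` : number of positions `i ≤ k ≤ j` with `s_k` even. -/
def eCount (s : Multiset ℕ) (i j : ℕ) : ℕ :=
  ((Finset.Icc i j).filter (fun k => Even (part s k))).card

/-- number of positions `i ≤ k ≤ j` with `s_k` odd. -/
def oCount (s : Multiset ℕ) (i j : ℕ) : ℕ :=
  ((Finset.Icc i j).filter (fun k => Odd (part s k))).card

/-- `s` is special in the e-count sense: `e_s(1,t₁)` is even, and
`e_s(tᵢ,tᵢ₊₁)` is even for all `1 ≤ i ≤ p-1`, where `t₁ < ⋯ < t_p` are the
positions of the odd parts of `s`. -/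
def IsSpecialE (s : Multiset ℕ) : Prop :=
  (∀ t, OddIdx s t → (∀ t', OddIdx s t' → t ≤ t') → Even (eCount s 1 t)) ∧
  (∀ i j, OddIdx s i → OddIdx s j → i < j →
    (∀ k, OddIdx s k → k ≤ i ∨ j ≤ k) → Even (eCount s i j))

/-- `s` is quasi-special: `e_s(1,t₁)` is even, `e_s(tᵢ,tᵢ₊₁)` is even for all
`1 ≤ i ≤ p-2`, and the smallest part of `s` is odd with multiplicity 1. -/
def IsQuasiSpecialE (s : Multiset ℕ) : Prop :=
  (∀ t, OddIdx s t → (∀ t', OddIdx s t' → t ≤ t') → Even (eCount s 1 t)) ∧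
  (∀ i j, OddIdx s i → OddIdx s j → i < j →
    (∀ k, OddIdx s k → k ≤ i ∨ j ≤ k) → (∃ k, OddIdx s k ∧ j < k) →
      Even (eCount s i j)) ∧
  Odd (minPart s) ∧ s.count (minPart s) = 1

/-- Number of odd parts greater than every even part (equals the number of odd
parts greater than the largest even part, and the number of all odd parts if
there are no even parts). -/
def numOddDominant (s : Multiset ℕ) : ℕ :=
  (s.filter (fun x => Odd x ∧ ∀ y ∈ s, Even y → y < x)).card

/-- Between every pair of consecutive even parts of `s` (in the decreasing
listing of the parts) there is an even number of odd parts. -/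
def EvenBetween (s : Multiset ℕ) : Prop :=
  ∀ i j, EvenIdx s i → EvenIdx s j → i < j →
    (∀ k, EvenIdx s k → k ≤ i ∨ j ≤ k) → Even (oCount s i j)

/-- A special B-partition. -/
def IsSpecialTypeB (s : Multiset ℕ) : Prop :=
  IsTypeB s ∧ EvenBetween s ∧ Odd (numOddDominant s)

/-- A special D-partition. -/
def IsSpecialTypeD (s : Multiset ℕ) : Prop :=
  IsTypeD s ∧ EvenBetween s ∧ Even (numOddDominant s)

/-- `g` lists the parts of `s` in decreasing order, followed by zeros. -/
def IsProfile (s : Multiset ℕ) (g : ℕ → ℕ) : Prop :=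
  Antitone g ∧ ∃ N, (∀ j, N ≤ j ↔ g j = 0) ∧ s = (Multiset.range N).map g

theorem sortedDesc_map_range {g : ℕ → ℕ} (hg : Antitone g) (N : ℕ) :
    sortedDesc ((Multiset.range N).map g) = (List.range N).map g := by
  have hsort : ((List.range N).map g).reverse.Pairwise (· ≤ ·) := by
    rw [List.pairwise_reverse, List.pairwise_map]
    exact (List.pairwise_lt_range (n := N)).imp fun h => hg h.le
  have hcoe : (Multiset.range N).map g = (((List.range N).map g).reverse : Multiset ℕ) := by
    rw [Multiset.coe_reverse]
    rfl
  rw [sortedDesc, hcoe, Multiset.coe_sort, List.mergeSort_eq_self _ (by simpa using hsort),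
    List.reverse_reverse]

theorem IsProfile.part_succ {s : Multiset ℕ} {g : ℕ → ℕ} (h : IsProfile s g) (j : ℕ) :
    part s (j + 1) = g j := by
  obtain ⟨hg, N, hN, rfl⟩ := h
  rw [part, sortedDesc_map_range hg]
  by_cases hj : j < N
  · simp [List.getD, hj]
  · simp [List.getD, hj, (hN j).1 (not_lt.1 hj)]

theorem psum_succ (s : Multiset ℕ) (j : ℕ) : psum s (j + 1) = psum s j + part s (j + 1) := by
  rw [psum, psum, part, Nat.add_sub_cancel, List.take_add_one, List.sum_append, List.getD]
  cases (sortedDesc s)[j]? <;> simp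

theorem IsProfile.psum_eq {s : Multiset ℕ} {g : ℕ → ℕ} (h : IsProfile s g) (j : ℕ) :
    psum s j = ∑ i ∈ Finset.range j, g i := by
  induction j with
  | zero => simp [psum]
  | succ j ih => rw [psum_succ, ih, h.part_succ, Finset.sum_range_succ]

theorem exists_isProfile {s : Multiset ℕ} (hs : PosParts s) : ∃ g, IsProfile s g := by
  have hlen : (sortedDesc s).length = Multiset.card s := by simp [sortedDesc]
  have hcoe : (sortedDesc s : Multiset ℕ) = s := by simp [sortedDesc]
  have hsort : (sortedDesc s).Pairwise (· ≥ ·) := by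
    rw [sortedDesc, List.pairwise_reverse]
    exact Multiset.pairwise_sort s (· ≤ ·)
  have hpos : ∀ j, Multiset.card s ≤ j ↔ (sortedDesc s).getD j 0 = 0 := by
    intro j
    rw [← hlen]
    constructor
    · intro h
      simp [List.getD, h]
    · intro h
      by_contra! hj
      have hmem : (sortedDesc s)[j] ∈ s := by
        have := List.getElem_mem hj
        rwa [← Multiset.mem_coe, hcoe] at this
      have := hs _ hmem
      simp [List.getD, hj] at h
      omega
  refine ⟨fun j => (sortedDesc s).getD j 0, ?_, Multiset.card s, hpos, ?_⟩
  · intro i j hij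
    by_cases hj : j < (sortedDesc s).length
    · rcases hij.eq_or_lt with rfl | hlt
      · exact le_rfl
      · have := List.pairwise_iff_getElem.1 hsort i j (by omega) hj hlt
        simpa [List.getD, hj, hlt.trans hj] using this
    · simp [List.getD, not_lt.1 hj]
  · conv_lhs => rw [← hcoe]
    refine congrArg Multiset.ofList ?_
    apply List.ext_getElem
    · simp [hlen]
    · intro i h1 h2
      simp [List.getD, h1]

theorem IsProfile.unique {s t : Multiset ℕ} {g : ℕ → ℕ} (hs : IsProfile s g)
    (ht : IsProfile t g) : s = t := by
  obtain ⟨-, N, hN, rfl⟩ := hs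
  obtain ⟨-, M, hM, rfl⟩ := ht
  have h1 : M ≤ N := (hM N).2 ((hN N).1 le_rfl)
  have h2 : N ≤ M := (hN M).2 ((hM M).1 le_rfl)
  rw [le_antisymm h1 h2]

theorem DomLE.antisymm {s t : Multiset ℕ} (hs : PosParts s) (ht : PosParts t)
    (h : DomLE s t) (h' : DomLE t s) : s = t := by
  obtain ⟨g, hg⟩ := exists_isProfile hs
  obtain ⟨k, hk⟩ := exists_isProfile ht
  have hp : psum s = psum t := funext fun j => le_antisymm (h j) (h' j)
  have : g = k := by
    funext j
    have h1 := psum_succ s j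
    have h2 := psum_succ t j
    rw [hg.part_succ, hp] at h1
    rw [hk.part_succ] at h2
    omega
  subst this
  exact hg.unique hk

theorem IsProfile.eventually_zero {s : Multiset ℕ} {g : ℕ → ℕ} (h : IsProfile s g) :
    ∃ N, ∀ j, N ≤ j → g j = 0 := by
  obtain ⟨-, N, hN, -⟩ := h
  exact ⟨N, fun j => (hN j).1⟩

theorem exists_profile_of_antitone {g : ℕ → ℕ} (hg : Antitone g) (h0 : ∃ N, g N = 0) :
    ∃ s, IsProfile s g := by
  classical
  refine ⟨_, hg, Nat.find h0, fun j => ⟨fun h => ?_, fun h => Nat.find_min' h0 h⟩, rfl⟩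
  have := hg h
  rw [Nat.find_spec h0] at this
  omega

theorem IsProfile.posParts {s : Multiset ℕ} {g : ℕ → ℕ} (h : IsProfile s g) : PosParts s := by
  obtain ⟨-, N, hN, rfl⟩ := h
  intro x hx
  simp only [Multiset.mem_map, Multiset.mem_range] at hx
  obtain ⟨j, hj, rfl⟩ := hx
  have := hN j
  by_contra h
  omega

theorem IsProfile.countP_eq {s : Multiset ℕ} {g : ℕ → ℕ} (h : IsProfile s g)
    (p : ℕ → Prop) [DecidablePred p] (h0 : ¬ p 0) {M : ℕ} (hM : g M = 0) :
    s.countP p = ((Finset.range M).filter fun k => p (g k)).card := by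
  obtain ⟨-, N, hN, rfl⟩ := h
  have hNM : N ≤ M := (hN M).2 hM
  have : ((Finset.range M).filter fun k => p (g k)) =
      (Finset.range N).filter fun k => p (g k) := by
    ext k
    simp only [Finset.mem_filter, Finset.mem_range]
    constructor
    · rintro ⟨h1, h2⟩
      refine ⟨?_, h2⟩
      by_contra! h
      rw [(hN k).1 h] at h2
      exact h0 h2
    · rintro ⟨h1, h2⟩
      exact ⟨by omega, h2⟩
  rw [this, Multiset.countP_map]
  rfl

theorem IsProfile.sum_eq {s : Multiset ℕ} {g : ℕ → ℕ} (h : IsProfile s g)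
    {M : ℕ} (hM : g M = 0) : s.sum = ∑ k ∈ Finset.range M, g k := by
  obtain ⟨-, N, hN, rfl⟩ := h
  have hNM : N ≤ M := (hN M).2 hM
  rw [← Finset.sum_subset (Finset.range_subset_range.2 hNM)
    fun k _ hk => (hN k).1 (by simpa using hk)]
  rfl

theorem IsProfile.mem_iff {s : Multiset ℕ} {g : ℕ → ℕ} (h : IsProfile s g) {x : ℕ} :
    x ∈ s ↔ 0 < x ∧ ∃ k, g k = x := by
  obtain ⟨-, N, hN, rfl⟩ := h
  simp only [Multiset.mem_map, Multiset.mem_range]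
  constructor
  · rintro ⟨k, hk, rfl⟩
    have := hN k
    exact ⟨by by_contra h; omega, k, rfl⟩
  · rintro ⟨h0, k, rfl⟩
    have := hN k
    exact ⟨k, by by_contra h; omega, rfl⟩

theorem even_countP_of_even_count {s : Multiset ℕ} {p : ℕ → Prop} [DecidablePred p]
    (h : ∀ x, p x → Even (s.count x)) : Even (s.countP p) := by
  rw [Multiset.countP_eq_card_filter, ← Multiset.toFinset_sum_count_eq]
  refine Finset.even_sum _ fun x hx => ?_
  have hpx : p x := (Multiset.mem_filter.1 (Multiset.mem_toFinset.1 hx)).2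
  rw [Multiset.count_filter_of_pos hpx]
  exact h x hpx

theorem even_countP_iff_of_count {s t : Multiset ℕ} {p : ℕ → Prop} [DecidablePred p]
    (h : ∀ x, p x → (Even (s.count x) ↔ Even (t.count x))) :
    Even (s.countP p) ↔ Even (t.countP p) := by
  have : Even ((s + t).countP p) := even_countP_of_even_count fun x hx => by
    rw [Multiset.count_add, Nat.even_add]
    exact h x hx
  rwa [Multiset.countP_add, Nat.even_add] at this

theorem even_card_filter_odd_iff (g : ℕ → ℕ) (M : ℕ) :
    Even ((Finset.range M).filter fun k => Odd (g k)).card ↔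
      Even (∑ k ∈ Finset.range M, g k) := by
  rw [← Nat.not_odd_iff_even, ← Nat.not_odd_iff_even, Finset.odd_sum_iff_odd_card_odd]

/-- The number of odd parts above the even part in position `j` is the number of odd
entries before position `j`. -/
theorem IsProfile.countP_odd_gt {s : Multiset ℕ} {g : ℕ → ℕ} (h : IsProfile s g) {j : ℕ}
    (hj : Even (g j)) :
    s.countP (fun x => Odd x ∧ g j < x) =
      ((Finset.range j).filter fun k => Odd (g k)).card := by
  obtain ⟨N, hN⟩ := h.eventually_zero
  rw [h.countP_eq _ (by simp) (hN (max N j) (le_max_left _ _))]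
  congr 1
  ext k
  simp only [Finset.mem_filter, Finset.mem_range]
  constructor
  · rintro ⟨-, ho, hlt⟩
    refine ⟨?_, ho⟩
    by_contra! hk
    exact absurd (h.1 hk) (not_le.2 hlt)
  · rintro ⟨hk, ho⟩
    refine ⟨lt_max_of_lt_right hk, ho, lt_of_le_of_ne (h.1 hk.le) fun he => ?_⟩
    rw [← he] at ho
    exact Nat.not_odd_iff_even.2 hj ho

theorem IsTypeB.even_sum_add_of_lt {s : Multiset ℕ} {g : ℕ → ℕ} (hs : IsTypeB s)
    (h : IsProfile s g) {j : ℕ} (hj : g (j + 1) < g j ∨ Odd (g j)) :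
    Even (∑ k ∈ Finset.range (j + 1), g k + (j + 1)) := by
  obtain ⟨N, hN⟩ := h.eventually_zero
  have hpos : 0 < g j := by
    rcases hj with hj | hj
    · omega
    · exact hj.pos
  have h1 : Even (s.countP fun x => Even x ∧ g j ≤ x) :=
    even_countP_of_even_count fun x hx => hs.2.2 x hx.1
  rw [h.countP_eq _ (by simp; omega) (hN (max N (j + 1)) (le_max_left _ _))] at h1
  have h2 : ((Finset.range (max N (j + 1))).filter fun k => Even (g k) ∧ g j ≤ g k) =
      (Finset.range (j + 1)).filter fun k => ¬ Odd (g k) := by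
    ext k
    simp only [Finset.mem_filter, Finset.mem_range, Nat.not_odd_iff_even]
    constructor
    · rintro ⟨-, he, hle⟩
      refine ⟨?_, he⟩
      by_contra! hk
      have h3 := h.1 hk
      have h4 := h.1 (Nat.le_succ j)
      rcases hj with hj | hj
      · simp only [Nat.succ_eq_add_one] at *
        omega
      · have : g k = g j := le_antisymm (by simp only [Nat.succ_eq_add_one] at *; omega) hle
        rw [this] at he
        exact Nat.not_odd_iff_even.2 he hj
    · rintro ⟨hk, he⟩
      exact ⟨lt_max_of_lt_right hk, he, h.1 (by omega)⟩
  rw [h2] at h1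
  have h3 := Finset.card_filter_add_card_filter_not (s := Finset.range (j + 1))
    (fun k => Odd (g k))
  have h4 := even_card_filter_odd_iff g (j + 1)
  rw [Finset.card_range] at h3
  have h5 := congrArg Even h3
  rw [Nat.even_add] at h5
  rw [Nat.even_add, ← h4, ← h5]
  tauto

theorem evenBetween_of_odd_countP {s : Multiset ℕ} (hs : PosParts s)
    (h : ∀ y ∈ s, Even y → Odd (s.countP fun x => Odd x ∧ y < x)) : EvenBetween s := by
  obtain ⟨g, hg⟩ := exists_isProfile hs
  have hmem : ∀ i, i < Multiset.card s → g i ∈ s := by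
    intro i hi
    obtain ⟨-, N, hN, rfl⟩ := hg
    simp only [Multiset.card_map, Multiset.card_range] at hi
    exact Multiset.mem_map_of_mem _ (Multiset.mem_range.2 hi)
  rintro i j ⟨hi1, hi2, hi3⟩ ⟨hj1, hj2, hj3⟩ hij -
  obtain ⟨i, rfl⟩ := Nat.exists_eq_add_of_le' hi1
  obtain ⟨j, rfl⟩ := Nat.exists_eq_add_of_le' hj1
  rw [hg.part_succ] at hi3 hj3
  have oi := h _ (hmem i hi2) hi3
  have oj := h _ (hmem j hj2) hj3
  rw [hg.countP_odd_gt hi3] at oi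
  rw [hg.countP_odd_gt hj3] at oj
  have hsplit : ((Finset.range j).filter fun k => Odd (g k)).card =
      ((Finset.range i).filter fun k => Odd (g k)).card + oCount s (i + 1) (j + 1) := by
    have himg : (Finset.Icc (i + 1) (j + 1)).filter (fun k => Odd (part s k)) =
        ((Finset.Ico i j).filter fun k => Odd (g k)).image (· + 1) := by
      ext k
      simp only [Finset.mem_filter, Finset.mem_Icc, Finset.mem_image, Finset.mem_Ico]
      constructor
      · rintro ⟨⟨h1, h2⟩, h3⟩
        obtain ⟨k, rfl⟩ := Nat.exists_eq_add_of_le' (show 1 ≤ k by omega)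
        rw [hg.part_succ] at h3
        refine ⟨k, ⟨⟨by omega, ?_⟩, h3⟩, rfl⟩
        by_contra! hk
        obtain rfl : k = j := by omega
        exact Nat.not_odd_iff_even.2 hj3 h3
      · rintro ⟨k, ⟨⟨h1, h2⟩, h3⟩, rfl⟩
        rw [hg.part_succ]
        exact ⟨⟨by omega, by omega⟩, h3⟩
    rw [oCount, himg, Finset.card_image_of_injective _ (add_left_injective 1),
      ← Finset.card_union_of_disjoint]
    · rw [← Finset.filter_union]
      congr 2
      ext k
      simp only [Finset.mem_union, Finset.mem_range, Finset.mem_Ico]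
      omega
    · refine Finset.disjoint_filter_filter ?_
      rw [Finset.disjoint_left]
      intro k
      simp only [Finset.mem_range, Finset.mem_Ico]
      omega
  rw [hsplit, Nat.odd_add'] at oj
  rw [← Nat.not_odd_iff_even]
  intro hc
  exact Nat.not_even_iff_odd.2 oi (oj.1 hc)

theorem even_countP_odd_iff_even_sum (s : Multiset ℕ) : Even (s.countP Odd) ↔ Even s.sum := by
  induction s using Multiset.induction_on with
  | empty => simp
  | cons a s ih =>
    rw [Multiset.countP_cons, Multiset.sum_cons]
    by_cases ha : Odd a
    · simp only [ha, if_true, Nat.even_add, ih]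
      have := Nat.not_even_iff_odd.2 ha
      simp [this]
    · have := Nat.not_odd_iff_even.1 ha
      simp [ha, Nat.even_add, ih, this]

theorem odd_numOddDominant_of_odd_countP {s : Multiset ℕ} (hs : Odd s.sum)
    (h : ∀ y ∈ s, Even y → Odd (s.countP fun x => Odd x ∧ y < x)) :
    Odd (numOddDominant s) := by
  rw [numOddDominant, ← Multiset.countP_eq_card_filter]
  by_cases he : ∃ y ∈ s, Even y
  · obtain ⟨y, hy, hmax⟩ := Finset.exists_max_image (s.toFinset.filter fun x => Even x) id (by
      obtain ⟨y, hy, hye⟩ := he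
      exact ⟨y, by simp [hy, hye]⟩)
    simp only [Finset.mem_filter, Multiset.mem_toFinset, id] at hy hmax
    convert h y hy.1 hy.2 using 1
    refine Multiset.countP_congr rfl fun x _ => propext ?_
    exact ⟨fun ⟨ho, hx⟩ => ⟨ho, hx y hy.1 hy.2⟩,
      fun ⟨ho, hx⟩ => ⟨ho, fun z hz hze => (hmax z ⟨hz, hze⟩).trans_lt hx⟩⟩
  · push Not at he
    have : s.countP (fun x => Odd x ∧ ∀ y ∈ s, Even y → y < x) = s.countP Odd :=
      Multiset.countP_congr rfl fun x _ => propext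
        ⟨And.left, fun ho => ⟨ho, fun y hy hye => absurd hye (he y hy)⟩⟩
    rw [this, ← Nat.not_even_iff_odd, even_countP_odd_iff_even_sum]
    exact Nat.not_even_iff_odd.2 hs

theorem count_muOdd (T : Multiset ℕ) (x : ℕ) :
    (muOdd T).count x =
      if Odd x ∧ x ∈ T then (if Even (T.count x) then 2 else 1) else 0 := by
  have h : (muOdd T).count x = ∑ y ∈ T.toFinset.filter (fun x => Odd x),
      if y = x then (if Even (T.count y) then 2 else 1) else 0 := by
    rw [muOdd, Multiset.count_bind]
    simp only [Multiset.count_replicate]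
    rfl
  rw [h, Finset.sum_ite_eq']
  simp only [Finset.mem_filter, Multiset.mem_toFinset, and_comm]

theorem odd_of_mem_muOdd {T : Multiset ℕ} {x : ℕ} (hx : x ∈ muOdd T) : Odd x := by
  by_contra h
  have := Multiset.count_pos.2 hx
  simp [count_muOdd, h] at this

theorem count_muOdd_le (T : Multiset ℕ) (x : ℕ) : (muOdd T).count x ≤ T.count x := by
  rw [count_muOdd]
  split_ifs with h1 h2
  · have := Multiset.count_pos.2 h1.2
    obtain ⟨r, hr⟩ := h2
    omega
  · exact Multiset.count_pos.2 h1.2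
  · exact Nat.zero_le _

theorem even_count_muOdd_iff (T : Multiset ℕ) {x : ℕ} (hx : Odd x) :
    Even ((muOdd T).count x) ↔ Even (T.count x) := by
  rw [count_muOdd]
  by_cases h : x ∈ T
  · by_cases h2 : Even (T.count x) <;> simp [hx, h, h2]
  · simp [h]

theorem isSpecialTypeD_muOdd {T : Multiset ℕ} (hT : Even T.sum) : IsSpecialTypeD (muOdd T) := by
  have hcard : Even ((muOdd T).countP Odd) := by
    rw [even_countP_iff_of_count fun x hx => even_count_muOdd_iff T hx]
    exact (even_countP_odd_iff_even_sum T).2 hT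
  refine ⟨⟨fun x hx => (odd_of_mem_muOdd hx).pos, (even_countP_odd_iff_even_sum _).1 hcard,
    fun x hx => ?_⟩, ?_, ?_⟩
  · rw [Multiset.count_eq_zero_of_notMem fun h => Nat.not_odd_iff_even.2 hx (odd_of_mem_muOdd h)]
    exact Even.zero
  · rintro i j ⟨hi1, hi2, hi3⟩
    exfalso
    have hlen : (sortedDesc (muOdd T)).length = Multiset.card (muOdd T) := by simp [sortedDesc]
    have hlt : i - 1 < (sortedDesc (muOdd T)).length := by omega
    have hmem : part (muOdd T) i ∈ muOdd T := by
      have hcoe : (sortedDesc (muOdd T) : Multiset ℕ) = muOdd T := by simp [sortedDesc]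
      have := List.getElem_mem hlt
      rwa [← Multiset.mem_coe, hcoe, ← List.getD_eq_getElem _ 0 hlt] at this
    exact Nat.not_odd_iff_even.2 hi3 (odd_of_mem_muOdd hmem)
  · rw [numOddDominant, ← Multiset.countP_eq_card_filter]
    convert hcard using 1
    refine Multiset.countP_congr rfl fun x _ => propext ⟨And.left, fun ho => ⟨ho, ?_⟩⟩
    exact fun y hy hye => absurd (odd_of_mem_muOdd hy) (Nat.not_odd_iff_even.2 hye)

theorem isProfile_transpose {l : Multiset ℕ} (hl : PosParts l) :
    IsProfile (transpose l) fun j => l.countP fun x => j + 1 ≤ x := by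
  obtain ⟨g, hg⟩ := exists_isProfile hl
  refine ⟨fun i j hij => ?_, part l 1, fun j => ?_, ?_⟩
  · simp only [Multiset.countP_eq_card_filter]
    exact Multiset.card_le_card (Multiset.monotone_filter_right _ fun x hx => by omega)
  · have h0 : part l 1 = g 0 := hg.part_succ 0
    rw [h0, Multiset.countP_eq_zero]
    constructor
    · intro h x hx
      obtain ⟨-, k, rfl⟩ := hg.mem_iff.1 hx
      have := hg.1 (Nat.zero_le k)
      omega
    · intro h
      by_contra! hj
      exact h (g 0) (hg.mem_iff.2 ⟨by omega, 0, rfl⟩) (by omega)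
  · simp only [transpose, Multiset.countP_eq_card_filter]

theorem odd_countP_iff_of_even_count {l : Multiset ℕ} {a : ℕ} (ha : Even (l.count a)) :
    Odd (l.countP fun x => a ≤ x) ↔ Odd (l.countP fun x => a + 1 ≤ x) := by
  have : l.countP (fun x => a ≤ x) = l.countP (fun x => a + 1 ≤ x) + l.count a := by
    clear ha
    induction l using Multiset.induction_on with
    | empty => simp
    | cons b l ih =>
      rw [Multiset.countP_cons, Multiset.countP_cons, Multiset.count_cons, ih]
      split_ifs <;> omega
  rw [this, Nat.odd_add]
  simp [ha]

theorem IsProfile.incMax {s : Multiset ℕ} {f : ℕ → ℕ} (h : IsProfile s f) (h0 : f 0 ≠ 0) :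
    IsProfile (incMax s) fun j => f j + if j = 0 then 1 else 0 := by
  have hp : part s 1 = f 0 := h.part_succ 0
  obtain ⟨hf, N, hN, rfl⟩ := h
  have hN0 : N ≠ 0 := by
    rintro rfl
    exact h0 ((hN 0).1 le_rfl)
  obtain ⟨M, rfl⟩ := Nat.exists_eq_succ_of_ne_zero hN0
  have hcons : ∀ k : ℕ → ℕ, (Multiset.range (M + 1)).map k =
      k 0 ::ₘ (Multiset.range M).map fun i => k (i + 1) := by
    intro k
    change (((List.range (M + 1)).map k : List ℕ) : Multiset ℕ) = _
    rw [List.range_succ_eq_map, List.map_cons, List.map_map]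
    rfl
  refine ⟨fun i j hij => ?_, M + 1, fun j => ?_, ?_⟩
  · have := hf hij
    dsimp only
    split_ifs <;> omega
  · by_cases hj : j = 0
    · simp [hj]
    · simpa [hj] using hN j
  · rw [WFPaper.incMax, hp, Nat.succ_eq_add_one, hcons, hcons, Multiset.erase_cons_head]
    simp

/-- The parts of the B-collapse of `T⁺`, for a partition `T` with parts `f` whose
consecutive entries in positions `2i` and `2i + 1` have equal parity. -/
def collapseProfile (f : ℕ → ℕ) : ℕ → ℕ
  | 0 => if Odd (f 0) then f 0 else f 0 + 1
  | k + 1 =>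
    if Odd (f (k + 1)) then f (k + 1)
    else if Even k then (if f (k + 1) = f (k + 2) then f (k + 1) else f (k + 1) - 1)
    else (if f k = f (k + 1) then f (k + 1) else f (k + 1) + 1)

theorem collapseProfile_odd (f : ℕ → ℕ) (i : ℕ) : collapseProfile f (2 * i + 1) =
    if Odd (f (2 * i + 1)) ∨ f (2 * i + 1) = f (2 * i + 2) then f (2 * i + 1)
    else f (2 * i + 1) - 1 := by
  simp only [collapseProfile, even_two_mul, if_true]
  split_ifs <;> tauto

theorem collapseProfile_even (f : ℕ → ℕ) (i : ℕ) : collapseProfile f (2 * i + 2) =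
    if Odd (f (2 * i + 2)) ∨ f (2 * i + 1) = f (2 * i + 2) then f (2 * i + 2)
    else f (2 * i + 2) + 1 := by
  have : ¬ Even (2 * i + 1) := by simp
  simp only [collapseProfile, this, if_false]
  split_ifs <;> tauto

theorem collapseProfile_of_odd {f : ℕ → ℕ} {k : ℕ} (hk : Odd (f k)) :
    collapseProfile f k = f k := by
  cases k <;> simp [collapseProfile, hk]

theorem odd_collapseProfile_zero (f : ℕ → ℕ) : Odd (collapseProfile f 0) := by
  rw [collapseProfile]
  split_ifs with h
  · exact h
  · exact (Nat.not_odd_iff_even.1 h).add_one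

theorem odd_collapseProfile_or_eq {f : ℕ → ℕ} (hf : Antitone f) (i : ℕ) :
    (Odd (collapseProfile f (2 * i + 1)) ∧ Odd (collapseProfile f (2 * i + 2))) ∨
    (Even (f (2 * i + 1)) ∧ f (2 * i + 1) = f (2 * i + 2) ∧
      collapseProfile f (2 * i + 1) = f (2 * i + 1) ∧
      collapseProfile f (2 * i + 2) = f (2 * i + 1)) := by
  rw [collapseProfile_odd, collapseProfile_even]
  have := hf (show 2 * i + 1 ≤ 2 * i + 2 by omega)
  simp only [Nat.odd_iff, Nat.even_iff]
  split_ifs <;> omega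

theorem antitone_collapseProfile {f : ℕ → ℕ} (hf : Antitone f)
    (hpar : ∀ i, Odd (f (2 * i)) ↔ Odd (f (2 * i + 1))) : Antitone (collapseProfile f) := by
  refine antitone_nat_of_succ_le fun k => ?_
  rcases k with _ | k
  · have h1 := hf (show 0 ≤ 1 by omega)
    have h2 := collapseProfile_odd f 0
    simp only [mul_zero, zero_add] at h2
    rw [zero_add, h2, collapseProfile]
    split_ifs <;> omega
  · rcases Nat.even_or_odd' k with ⟨i, rfl | rfl⟩
    · rw [show 2 * i + 1 + 1 = 2 * i + 2 by omega, collapseProfile_odd, collapseProfile_even]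
      have := hf (show 2 * i + 1 ≤ 2 * i + 2 by omega)
      simp only [Nat.odd_iff]
      split_ifs <;> omega
    · rw [show 2 * i + 1 + 1 + 1 = 2 * (i + 1) + 1 by omega,
        show 2 * i + 1 + 1 = 2 * i + 2 by omega, collapseProfile_odd, collapseProfile_even]
      have h1 := hf (show 2 * i + 2 ≤ 2 * (i + 1) + 1 by omega)
      have h2 := hpar (i + 1)
      rw [show 2 * (i + 1) = 2 * i + 2 by omega] at h2 h1 ⊢
      simp only [Nat.odd_iff] at h2 ⊢
      split_ifs <;> omega

theorem even_sum_range_two_mul {f : ℕ → ℕ} (hpar : ∀ i, Odd (f (2 * i)) ↔ Odd (f (2 * i + 1)))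
    (i : ℕ) : Even (∑ k ∈ Finset.range (2 * i), f k) := by
  induction i with
  | zero => simp
  | succ i ih =>
    rw [show 2 * (i + 1) = 2 * i + 1 + 1 by omega, Finset.sum_range_succ, Finset.sum_range_succ]
    have := hpar i
    simp only [Nat.odd_iff, Nat.even_iff] at *
    omega

theorem sum_range_collapseProfile {f : ℕ → ℕ} (hf : Antitone f)
    (hpar : ∀ i, Odd (f (2 * i)) ↔ Odd (f (2 * i + 1))) (i : ℕ) :
    (∑ k ∈ Finset.range (2 * i + 1), collapseProfile f k =
      ∑ k ∈ Finset.range (2 * i + 1), f k + if Even (f (2 * i)) then 1 else 0) ∧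
    ∑ k ∈ Finset.range (2 * i + 2), collapseProfile f k =
      ∑ k ∈ Finset.range (2 * i + 2), f k +
        if Even (f (2 * i + 1)) ∧ f (2 * i + 1) = f (2 * i + 2) then 1 else 0 := by
  have step : ∀ i, (∑ k ∈ Finset.range (2 * i + 1), collapseProfile f k =
      ∑ k ∈ Finset.range (2 * i + 1), f k + if Even (f (2 * i)) then 1 else 0) →
    ∑ k ∈ Finset.range (2 * i + 2), collapseProfile f k =
      ∑ k ∈ Finset.range (2 * i + 2), f k +
        if Even (f (2 * i + 1)) ∧ f (2 * i + 1) = f (2 * i + 2) then 1 else 0 := by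
    intro i h
    rw [show 2 * i + 2 = 2 * i + 1 + 1 by omega, Finset.sum_range_succ,
      Finset.sum_range_succ _ (2 * i + 1), h, collapseProfile_odd,
      show 2 * i + 1 + 1 = 2 * i + 2 by omega]
    have h1 := hpar i
    have h2 := hf (show 2 * i + 1 ≤ 2 * i + 2 by omega)
    simp only [Nat.odd_iff, Nat.even_iff] at *
    split_ifs <;> omega
  have main : ∑ k ∈ Finset.range (2 * i + 1), collapseProfile f k =
      ∑ k ∈ Finset.range (2 * i + 1), f k + if Even (f (2 * i)) then 1 else 0 := by
    induction i with
    | zero =>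
      simp only [mul_zero, zero_add, Finset.range_one, Finset.sum_singleton, collapseProfile,
        Nat.odd_iff, Nat.even_iff]
      split_ifs <;> omega
    | succ i ih =>
      rw [show 2 * (i + 1) = 2 * i + 2 by omega, Finset.sum_range_succ,
        Finset.sum_range_succ _ (2 * i + 2), step i ih, collapseProfile_even]
      simp only [Nat.odd_iff, Nat.even_iff] at *
      split_ifs <;> omega
  exact ⟨main, step i main⟩

theorem odd_card_filter_range_iff {p : ℕ → Prop} [DecidablePred p]
    (hp : ∀ i, p (2 * i + 1) ↔ p (2 * i + 2)) (i : ℕ) :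
    Odd ((Finset.range (2 * i + 1)).filter p).card ↔ p 0 := by
  induction i with
  | zero =>
    by_cases h : p 0 <;> simp [Finset.filter_singleton, h]
  | succ i ih =>
    rw [show 2 * (i + 1) + 1 = 2 * i + 1 + 1 + 1 by omega, ← ih, Finset.range_add_one,
      Finset.filter_insert, Finset.range_add_one, Finset.filter_insert]
    have := hp i
    rw [show 2 * i + 2 = 2 * i + 1 + 1 by omega] at this
    split_ifs with h1 h2 h2
    · rw [Finset.card_insert_of_notMem (by simp), Finset.card_insert_of_notMem (by simp)]
      simp [Nat.odd_iff]
      omega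
    · tauto
    · tauto
    · rfl

theorem odd_card_odd_collapseProfile {f : ℕ → ℕ} (hf : Antitone f) (i : ℕ) :
    Odd ((Finset.range (2 * i + 1)).filter fun k => Odd (collapseProfile f k)).card := by
  rw [odd_card_filter_range_iff (p := fun k => Odd (collapseProfile f k)) fun j => ?_]
  · exact odd_collapseProfile_zero f
  · rcases odd_collapseProfile_or_eq hf j with ⟨h1, h2⟩ | ⟨-, -, h1, h2⟩
    · exact iff_of_true h1 h2
    · rw [h1, h2]

theorem collapseProfile_eq_zero {f : ℕ → ℕ} {N : ℕ} (hN : ∀ j, N ≤ j → f j = 0) :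
    collapseProfile f (2 * N + 1) = 0 ∧ f (2 * N + 1) = 0 := by
  have h1 := hN (2 * N + 1) (by omega)
  have h2 := hN (2 * N + 2) (by omega)
  rw [collapseProfile_odd, h1, h2]
  simp

theorem isTypeB_of_isProfile_collapseProfile {f : ℕ → ℕ} (hf : Antitone f) {s : Multiset ℕ}
    (hs : IsProfile s (collapseProfile f)) {N : ℕ} (hN : ∀ j, N ≤ j → f j = 0) : IsTypeB s := by
  have hz := (collapseProfile_eq_zero hN).1
  refine ⟨hs.posParts, ?_, fun x hx => ?_⟩
  · rw [hs.sum_eq hz, ← Nat.not_even_iff_odd, ← even_card_filter_odd_iff, Nat.not_even_iff_odd]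
    exact odd_card_odd_collapseProfile hf N
  · rcases Nat.eq_zero_or_pos x with rfl | hpos
    · rw [Multiset.count_eq_zero_of_notMem fun h => (hs.posParts 0 h).false]
      exact Even.zero
    · rw [Multiset.count, hs.countP_eq (fun y => x = y) hpos.ne' hz, ← Nat.not_odd_iff_even,
        odd_card_filter_range_iff (p := fun k => x = collapseProfile f k) fun j => ?_]
      · rintro rfl
        exact Nat.not_odd_iff_even.2 hx (odd_collapseProfile_zero f)
      · rcases odd_collapseProfile_or_eq hf j with ⟨h1, h2⟩ | ⟨-, -, h1, h2⟩
        · refine iff_of_false ?_ ?_ <;> rintro rfl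
          exacts [Nat.not_odd_iff_even.2 hx h1, Nat.not_odd_iff_even.2 hx h2]
        · rw [h1, h2]

/-- A B-partition `s ≤ T⁺` can only touch `T⁺` with the wrong parity inside a run of
equal even parts. -/
theorem eq_succ_and_even_of_touch {f : ℕ → ℕ} (hf : Antitone f)
    {s : Multiset ℕ} {h : ℕ → ℕ} (hs : IsTypeB s) (hh : IsProfile s h)
    (hle : ∀ j, ∑ k ∈ Finset.range j, h k ≤ ∑ k ∈ Finset.range j, f k + 1) {j : ℕ}
    (heq : ∑ k ∈ Finset.range (j + 1), h k = ∑ k ∈ Finset.range (j + 1), f k + 1)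
    (hodd : Odd (∑ k ∈ Finset.range (j + 1), h k + (j + 1))) :
    f j = f (j + 1) ∧ Even (f j) := by
  have hev : ¬ (h (j + 1) < h j ∨ Odd (h j)) := fun hc =>
    Nat.not_even_iff_odd.2 hodd (hs.even_sum_add_of_lt hh hc)
  push Not at hev
  have h1 := hle j
  have h2 := hle (j + 2)
  have h3 := hh.1 (Nat.le_succ j)
  have h4 := hf (Nat.le_succ j)
  rw [Finset.sum_range_succ, Finset.sum_range_succ _ (j + 1), heq] at h2
  rw [Finset.sum_range_succ, Finset.sum_range_succ] at heq
  simp only [Nat.succ_eq_add_one] at h3 h4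
  obtain ⟨hev1, hev2⟩ := hev
  rw [Nat.not_odd_iff_even] at hev2
  have : f j = h j := by omega
  exact ⟨by omega, this ▸ hev2⟩

theorem sum_range_le_collapseProfile {f : ℕ → ℕ} (hf : Antitone f)
    (hpar : ∀ i, Odd (f (2 * i)) ↔ Odd (f (2 * i + 1)))
    {s : Multiset ℕ} {h : ℕ → ℕ} (hs : IsTypeB s) (hh : IsProfile s h)
    (hle : ∀ j, ∑ k ∈ Finset.range j, h k ≤ ∑ k ∈ Finset.range j, f k + 1) (j : ℕ) :
    ∑ k ∈ Finset.range j, h k ≤ ∑ k ∈ Finset.range j, collapseProfile f k := by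
  rcases j with _ | j
  · simp
  have h1 := hle (j + 1)
  rcases Nat.even_or_odd' j with ⟨i, rfl | rfl⟩
  · rw [(sum_range_collapseProfile hf hpar i).1]
    split_ifs with he
    · exact h1
    by_contra! hc
    have heq : ∑ k ∈ Finset.range (2 * i + 1), h k =
      ∑ k ∈ Finset.range (2 * i + 1), f k + 1 := by omega
    refine he (eq_succ_and_even_of_touch hf hs hh hle heq ?_).2
    have h2 := even_sum_range_two_mul hpar i
    rw [heq, Finset.sum_range_succ]
    simp only [Nat.odd_iff, Nat.even_iff] at *
    omega
  · rw [show 2 * i + 1 + 1 = 2 * i + 2 by omega, (sum_range_collapseProfile hf hpar i).2] at *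
    split_ifs with he
    · exact h1
    by_contra! hc
    have heq : ∑ k ∈ Finset.range (2 * i + 2), h k =
      ∑ k ∈ Finset.range (2 * i + 2), f k + 1 := by omega
    have h2 := even_sum_range_two_mul hpar (i + 1)
    obtain ⟨h3, h4⟩ := eq_succ_and_even_of_touch (j := 2 * i + 1) hf hs hh hle heq (by
      rw [show 2 * i + 1 + 1 = 2 * (i + 1) by omega, show 2 * (i + 1) = 2 * i + 2 by omega,
        heq, show 2 * i + 2 = 2 * (i + 1) by omega]
      simp only [Nat.odd_iff, Nat.even_iff] at *
      omega)
    exact he ⟨h4, h3⟩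

theorem isProfile_collapse {f : ℕ → ℕ} (hf : Antitone f)
    (hpar : ∀ i, Odd (f (2 * i)) ↔ Odd (f (2 * i + 1)))
    {T d : Multiset ℕ} (hT : IsProfile T f) (h0 : f 0 ≠ 0)
    (hd : IsCollapse IsTypeB (incMax T) d) : IsProfile d (collapseProfile f) := by
  obtain ⟨N, hN⟩ := hT.eventually_zero
  obtain ⟨s, hs⟩ := exists_profile_of_antitone (antitone_collapseProfile hf hpar)
    ⟨_, (collapseProfile_eq_zero hN).1⟩
  have hsB := isTypeB_of_isProfile_collapseProfile hf hs hN
  have hI := hT.incMax h0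
  have hIsum : ∀ j, psum (incMax T) (j + 1) = ∑ k ∈ Finset.range (j + 1), f k + 1 := by
    intro j
    rw [hI.psum_eq, Finset.sum_add_distrib, Finset.sum_ite_eq' (Finset.range (j + 1))]
    simp
  obtain ⟨hdB, -, hdle, hmax⟩ := hd
  have hsum : s.sum = (incMax T).sum := by
    have hz := collapseProfile_eq_zero hN
    rw [hs.sum_eq hz.1, hI.sum_eq (M := 2 * N + 1) (by simp [hz.2]), ← hI.psum_eq, hIsum,
      (sum_range_collapseProfile hf hpar N).1, hN (2 * N) (by omega)]
    simp
  have hsle : DomLE s (incMax T) := by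
    intro j
    rcases j with _ | j
    · simp [psum]
    rw [hs.psum_eq, hIsum]
    rcases Nat.even_or_odd' j with ⟨i, rfl | rfl⟩
    · rw [(sum_range_collapseProfile hf hpar i).1]
      split_ifs <;> omega
    · rw [show 2 * i + 1 + 1 = 2 * i + 2 by omega, (sum_range_collapseProfile hf hpar i).2]
      split_ifs <;> omega
  obtain ⟨h, hh⟩ := exists_isProfile hdB.1
  have hds : DomLE d s := by
    intro j
    rw [hs.psum_eq, hh.psum_eq]
    refine sum_range_le_collapseProfile hf hpar hdB hh (fun j => ?_) j
    rcases j with _ | j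
    · simp
    · rw [← hh.psum_eq, ← hIsum]
      exact hdle _
  rwa [DomLE.antisymm hdB.1 hs.posParts hds (hmax s hsB hsum hsle)]

theorem count_le_count_of_collapseProfile {T d : Multiset ℕ} {f : ℕ → ℕ} (hT : IsProfile T f)
    (hd : IsProfile d (collapseProfile f)) {x : ℕ} (hx : Odd x) : T.count x ≤ d.count x := by
  obtain ⟨N, hN⟩ := hT.eventually_zero
  have hz := collapseProfile_eq_zero hN
  unfold Multiset.count
  rw [hT.countP_eq (fun y => x = y) hx.pos.ne' hz.2,
    hd.countP_eq (fun y => x = y) hx.pos.ne' hz.1]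
  refine Finset.card_le_card fun k => ?_
  simp only [Finset.mem_filter]
  rintro ⟨hk, rfl⟩
  exact ⟨hk, (collapseProfile_of_odd hx).symm⟩

theorem odd_countP_sub_muOdd {T d : Multiset ℕ} {f : ℕ → ℕ}
    (hpar : ∀ i, Odd (f (2 * i)) ↔ Odd (f (2 * i + 1))) (hT : IsProfile T f)
    (hd : IsProfile d (collapseProfile f)) (hle : muOdd T ≤ d) {y : ℕ} (hy : y ∈ d)
    (hye : Even y) : Odd ((d - muOdd T).countP fun x => Odd x ∧ y < x) := by
  obtain ⟨-, k, rfl⟩ := hd.mem_iff.1 hy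
  have hk : ∃ i, k = 2 * i + 1 ∨ k = 2 * i + 2 := by
    rcases k with _ | k
    · exact absurd (odd_collapseProfile_zero f) (Nat.not_odd_iff_even.2 hye)
    · rcases Nat.even_or_odd' k with ⟨i, rfl | rfl⟩
      exacts [⟨i, Or.inl rfl⟩, ⟨i, Or.inr rfl⟩]
  obtain ⟨i, hi⟩ := hk
  obtain ⟨h1, h2, h3, h4⟩ : Even (f (2 * i + 1)) ∧ f (2 * i + 1) = f (2 * i + 2) ∧
      collapseProfile f (2 * i + 1) = f (2 * i + 1) ∧
      collapseProfile f (2 * i + 2) = f (2 * i + 1) := by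
    rcases odd_collapseProfile_or_eq hT.1 i with ⟨h1, h2⟩ | h
    · rcases hi with rfl | rfl
      exacts [absurd h1 (Nat.not_odd_iff_even.2 hye), absurd h2 (Nat.not_odd_iff_even.2 hye)]
    · exact h
  have hk : collapseProfile f k = f (2 * i + 1) := by rcases hi with rfl | rfl <;> assumption
  rw [hk]
  have hdo : Odd (d.countP fun x => Odd x ∧ f (2 * i + 1) < x) := by
    rw [← h3, hd.countP_odd_gt (h3.symm ▸ h1)]
    exact odd_card_odd_collapseProfile hT.1 i
  have hTe : Even (T.countP fun x => Odd x ∧ f (2 * i + 1) < x) := by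
    rw [h2, hT.countP_odd_gt (h2 ▸ h1), even_card_filter_odd_iff]
    exact even_sum_range_two_mul hpar (i + 1)
  rw [Multiset.countP_sub hle, Nat.odd_sub (Multiset.countP_le_of_le _ hle)]
  rw [← even_countP_iff_of_count fun x hx => even_count_muOdd_iff T hx.1] at hTe
  simp [hdo, hTe]

/-- For a C-partition `λ` of `n ≥ 1` with `|μ(λ)| ≠ 2` and
`d(λ) = ((λᵗ)⁺)_B`: `|μ(λ)|` is even, `μ(λ)` is a special D-partition,
`μ(λ) ⊆ d(λ)`, and `d(λ) ∖ μ(λ)` is a special B-partition. -/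
theorem statement7 (n : ℕ) (hn : 1 ≤ n) (l : Multiset ℕ)
    (hC : IsTypeC l ∧ l.sum = 2 * n)
    (hmu : (muOdd (transpose l)).sum ≠ 2)
    (d : Multiset ℕ) (hd : IsCollapse IsTypeB (incMax (transpose l)) d) :
    Even (muOdd (transpose l)).sum ∧
    IsSpecialTypeD (muOdd (transpose l)) ∧
    muOdd (transpose l) ≤ d ∧
    IsSpecialTypeB (d - muOdd (transpose l)) := by
  obtain ⟨⟨hpos, -, hodd⟩, hsum⟩ := hC
  have hT := isProfile_transpose hpos
  set f : ℕ → ℕ := fun j => l.countP fun x => j + 1 ≤ x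
  have hpar : ∀ i, Odd (f (2 * i)) ↔ Odd (f (2 * i + 1)) := fun i =>
    odd_countP_iff_of_even_count (hodd _ (odd_two_mul_add_one i))
  have h0 : f 0 ≠ 0 := by
    obtain ⟨x, hx⟩ := Multiset.exists_mem_of_ne_zero (s := l) (by rintro rfl; simp at hsum; omega)
    exact (Multiset.countP_pos_of_mem hx (hpos x hx)).ne'
  have hprof := isProfile_collapse hT.1 hpar hT h0 hd
  have hTsum : Even (transpose l).sum := by
    obtain ⟨N, hN⟩ := hT.eventually_zero
    rw [hT.sum_eq (hN (2 * N) (by omega))]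
    exact even_sum_range_two_mul hpar N
  have hD := isSpecialTypeD_muOdd hTsum
  have hle : muOdd (transpose l) ≤ d := by
    refine Multiset.le_iff_count.2 fun x => ?_
    by_cases hx : Odd x
    · exact (count_muOdd_le _ x).trans (count_le_count_of_collapseProfile hT hprof hx)
    · rw [Multiset.count_eq_zero_of_notMem fun h => hx (odd_of_mem_muOdd h)]
      exact Nat.zero_le _
  have hodd' : ∀ y ∈ d - muOdd (transpose l), Even y →
      Odd ((d - muOdd (transpose l)).countP fun x => Odd x ∧ y < x) := fun y hy hye =>
    odd_countP_sub_muOdd hpar hT hprof hle (Multiset.mem_of_le (Multiset.sub_le_self _ _) hy) hye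
  have hB : IsTypeB (d - muOdd (transpose l)) := by
    refine ⟨fun x hx => hd.1.1 x (Multiset.mem_of_le (Multiset.sub_le_self _ _) hx), ?_,
      fun x hx => ?_⟩
    · have h1 := hd.1.2.1
      rw [← Multiset.sub_add_cancel hle, Multiset.sum_add, Nat.odd_add] at h1
      exact h1.2 hD.1.2.1
    · rw [Multiset.count_sub]
      exact (hd.1.2.2 x hx).tsub (hD.1.2.2 x hx)
  exact ⟨hD.1.2.1, hD, hle, hB, evenBetween_of_odd_countP hB.1 hodd',
    odd_numOddDominant_of_odd_countP hB.2.1 hodd'⟩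

end WFPaper
end

section
/- Let n ≥ 1 and let λ be a D-partition of n. Then |μ(λ)| = 2n−2 if and only if λ = (1,1) or λ = (3,1). -/
namespace WFPaper

theorem muOdd_sum (T : Multiset ℕ) :
    (muOdd T).sum =
      ∑ x ∈ T.toFinset.filter (fun x => Odd x), (if Even (T.count x) then 2 else 1) * x := by
  simp only [muOdd, Multiset.sum_bind, Multiset.sum_replicate, smul_eq_mul]
  rfl

theorem muOdd_sum_add_count_mul_le {T : Multiset ℕ} {a : ℕ} (ha : Even a) :
    (muOdd T).sum + T.count a * a ≤ T.sum := by
  have hodd : (muOdd T).sum ≤ ∑ x ∈ T.toFinset.filter (fun x => Odd x), T.count x * x := by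
    rw [muOdd_sum]
    refine Finset.sum_le_sum fun x hx => Nat.mul_le_mul_right x ?_
    have hpos : 0 < T.count x := Multiset.count_pos.2 (by simpa using (Finset.mem_filter.1 hx).1)
    split_ifs with h
    · obtain ⟨k, hk⟩ := h
      omega
    · exact hpos
  have heven : T.count a * a ≤ ∑ x ∈ T.toFinset.filter (fun x => ¬ Odd x), T.count x * x := by
    by_cases hm : a ∈ T
    · exact Finset.single_le_sum (f := fun x => T.count x * x) (fun _ _ => Nat.zero_le _)
        (by simp [hm, ha])
    · simp [Multiset.count_eq_zero_of_notMem hm]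
  have hsum : T.sum = ∑ x ∈ T.toFinset, T.count x * x := by
    simpa using Finset.sum_multiset_count T
  rw [hsum, ← Finset.sum_filter_add_sum_filter_not T.toFinset (fun x => Odd x)]
  exact Nat.add_le_add hodd heven

theorem sum_map_range_card_filter (s : Multiset ℕ) (M : ℕ) (h : ∀ x ∈ s, x ≤ M) :
    ((Multiset.range M).map (fun j => (s.filter (fun x => j + 1 ≤ x)).card)).sum = s.sum := by
  change ∑ j ∈ Finset.range M, (s.filter (fun x => j + 1 ≤ x)).card = s.sum
  induction s using Multiset.induction_on with
  | empty => simp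
  | cons a s ih =>
    have ha : a ≤ M := h a (Multiset.mem_cons_self a s)
    have hcard : ((Finset.range M).filter (fun j => j + 1 ≤ a)) = Finset.range a := by
      ext j
      simp only [Finset.mem_filter, Finset.mem_range]
      omega
    simp only [Multiset.filter_cons, Multiset.card_add, Finset.sum_add_distrib, Multiset.sum_cons]
    rw [ih fun x hx => h x (Multiset.mem_cons_of_mem hx)]
    simp only [apply_ite Multiset.card, Multiset.card_singleton, Multiset.card_zero]
    rw [← Finset.card_filter, hcard, Finset.card_range]

theorem le_part_one {s : Multiset ℕ} {x : ℕ} (hx : x ∈ s) : x ≤ part s 1 := by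
  have hx' : x ∈ sortedDesc s := by simpa [sortedDesc] using hx
  have hp : (sortedDesc s).Pairwise (· ≥ ·) := by
    rw [sortedDesc, List.pairwise_reverse]
    exact Multiset.pairwise_sort s (· ≤ ·)
  unfold part
  cases hl : sortedDesc s with
  | nil => simp [hl] at hx'
  | cons a t =>
    rw [hl] at hx' hp
    rcases List.mem_cons.1 hx' with rfl | h
    · simp
    · simpa using (List.pairwise_cons.1 hp).1 x h

theorem part_one_mem {s : Multiset ℕ} (hs : s ≠ 0) : part s 1 ∈ s := by
  have hmem : ∀ x, x ∈ sortedDesc s → x ∈ s := by simp [sortedDesc]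
  unfold part
  cases hl : sortedDesc s with
  | nil =>
    obtain ⟨x, hx⟩ := Multiset.exists_mem_of_ne_zero hs
    have hx' : x ∈ sortedDesc s := by simpa [sortedDesc] using hx
    simp [hl] at hx'
  | cons a t => exact hmem _ (by simp [hl])

theorem transpose_sum (s : Multiset ℕ) : (transpose s).sum = s.sum :=
  sum_map_range_card_filter s _ fun _ => le_part_one

theorem even_card_filter_odd_iff_s11 (s : Multiset ℕ) :
    Even (s.filter (fun x => Odd x)).card ↔ Even s.sum := by
  induction s using Multiset.induction_on with
  | empty => simp
  | cons a s ih =>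
    by_cases ha : Odd a
    · have ha' : ¬ Even a := by simpa using ha
      rw [Multiset.filter_cons_of_pos _ ha, Multiset.card_cons, Multiset.sum_cons, Nat.even_add_one,
        Nat.even_add, ih]
      tauto
    · have ha' : Even a := by simpa using ha
      simp [ha, Nat.even_add, ih, ha']

theorem IsTypeD.even_card {s : Multiset ℕ} (h : IsTypeD s) : Even s.card := by
  rw [← Multiset.filter_add_not (fun x => Odd x) s, Multiset.card_add]
  refine ((even_card_filter_odd_iff_s11 s).2 h.2.1).add ?_
  rw [← Multiset.toFinset_sum_count_eq]
  refine Finset.even_sum _ fun x hx => ?_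
  have hx' : ¬ Odd x := (Multiset.mem_filter.1 (Multiset.mem_toFinset.1 hx)).2
  rw [Multiset.count_filter_of_pos (p := fun a => ¬ Odd a) hx']
  exact h.2.2 x (by simpa using hx')

theorem card_mem_transpose {s : Multiset ℕ} (hp : PosParts s) (hs : s ≠ 0) :
    s.card ∈ transpose s := by
  refine Multiset.mem_map.2 ⟨0, Multiset.mem_range.2 (hp _ (part_one_mem hs)), ?_⟩
  rw [Multiset.filter_eq_self.2]
  exact fun x hx => hp x hx

theorem one_lt_count_card_transpose {s : Multiset ℕ} (hs : s ≠ 0) (h2 : ∀ x ∈ s, 2 ≤ x) :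
    1 < (transpose s).count s.card := by
  have hM : 2 ≤ part s 1 := h2 _ (part_one_mem hs)
  have hfull : ∀ j < 2, (s.filter (fun x => j + 1 ≤ x)).card = s.card := by
    intro j hj
    rw [Multiset.filter_eq_self.2]
    intro x hx
    have := h2 x hx
    omega
  rw [transpose, Multiset.count_map]
  change 1 < ((Finset.range (part s 1)).filter
    (fun j => s.card = (s.filter (fun x => j + 1 ≤ x)).card)).card
  rw [Finset.one_lt_card]
  refine ⟨0, ?_, 1, ?_, zero_ne_one⟩
  · exact Finset.mem_filter.2 ⟨Finset.mem_range.2 (by omega), (hfull 0 (by omega)).symm⟩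
  · exact Finset.mem_filter.2 ⟨Finset.mem_range.2 (by omega), (hfull 1 (by omega)).symm⟩

theorem muOdd_sum_le_two {T : Multiset ℕ} (h : ∀ x ∈ T, x ≤ 2) : (muOdd T).sum ≤ 2 := by
  have hsub : T.toFinset.filter (fun x => Odd x) ⊆ {1} := by
    intro x hx
    obtain ⟨hx, k, hk⟩ := Finset.mem_filter.1 hx
    have := h x (Multiset.mem_toFinset.1 hx)
    simp only [Finset.mem_singleton]
    omega
  rw [muOdd_sum]
  refine (Finset.sum_le_sum_of_subset hsub).trans ?_
  rw [Finset.sum_singleton]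
  split_ifs <;> omega

theorem part_one_eq {s : Multiset ℕ} {a : ℕ} (ha : a ∈ s) (h : ∀ x ∈ s, x ≤ a) :
    part s 1 = a :=
  le_antisymm (h _ (part_one_mem fun h0 => by simp [h0] at ha)) (le_part_one ha)

theorem le_three_of_muOdd_transpose_pair {a : ℕ}
    (h : a + 1 ≤ (muOdd (transpose {a, 1})).sum + 2) : a ≤ 3 := by
  have hle : ∀ x ∈ transpose {a, 1}, x ≤ 2 := by
    intro x hx
    obtain ⟨j, -, rfl⟩ := Multiset.mem_map.1 hx
    exact Multiset.card_le_card (Multiset.filter_le _ _)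
  have := muOdd_sum_le_two hle
  omega

/-- For a D-partition `λ` of `n ≥ 1`: `|μ(λ)| = 2n - 2` iff
`λ = (1,1)` or `λ = (3,1)`. -/
theorem statement11 (n : ℕ) (hn : 1 ≤ n) (l : Multiset ℕ)
    (hD : IsTypeD l ∧ l.sum = 2 * n) :
    (muOdd (transpose l)).sum = 2 * n - 2 ↔
      l = ({1, 1} : Multiset ℕ) ∨ l = ({3, 1} : Multiset ℕ) := by
  obtain ⟨hD, hs⟩ := hD
  have hl : l ≠ 0 := by
    rintro rfl
    simp at hs
    omega
  constructor
  · intro h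
    have hc := hD.even_card
    have hbound := muOdd_sum_add_count_mul_le (T := transpose l) hc
    rw [transpose_sum, hs, h] at hbound
    have hbound' : (transpose l).count l.card * l.card ≤ 2 := by omega
    have hcount : 0 < (transpose l).count l.card :=
      Multiset.count_pos.2 (card_mem_transpose hD.1 hl)
    have hcard : l.card = 2 := by
      have hpos : 0 < l.card := Multiset.card_pos.2 hl
      have : l.card ≤ 2 := (Nat.le_mul_of_pos_left _ hcount).trans hbound'
      obtain ⟨k, hk⟩ := hc
      omega
    have hone : 1 ∈ l := by
      by_contra hnot
      have := one_lt_count_card_transpose hl fun x hx => by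
        have := hD.1 x hx
        have : x ≠ 1 := fun hx1 => hnot (hx1 ▸ hx)
        omega
      rw [hcard] at this hbound'
      omega
    obtain ⟨t, rfl⟩ := Multiset.exists_cons_of_mem hone
    obtain ⟨a, rfl⟩ := Multiset.card_eq_one.1 (by simpa using hcard)
    have hpair : (1 ::ₘ {a} : Multiset ℕ) = {a, 1} := Multiset.pair_comm 1 a
    rw [hpair] at h hs ⊢
    have hsum : a + 1 = 2 * n := by simpa using hs
    have ha : a ≤ 3 := le_three_of_muOdd_transpose_pair (by omega)
    have : a = 1 ∨ a = 3 := by omega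
    exact this.imp (by rintro rfl; rfl) (by rintro rfl; rfl)
  · rintro (rfl | rfl)
    · have hn1 : n = 1 := by simp at hs; omega
      rw [transpose, part_one_eq (a := 1) (by simp) (by simp), hn1]
      decide
    · have hn2 : n = 2 := by simp at hs; omega
      rw [transpose, part_one_eq (a := 3) (by simp) (by simp), hn2]
      decide

end WFPaper
end
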